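/- Let S be the graph obtained from the Herschel graph 𝔥 by replacing each vertex h_i (i ∈ {1,2,3}) with two new adjacent vertices h_i′ and h_i″, where h_i′ is adjacent to h_{i−1}¹ and h_{i−1}² and h_i″ is adjacent to h_i¹ and h_i² (subscripts modulo 3 in {1,2,3}), all other vertices and edges of 𝔥 being unchanged. Then S contains the complete bipartite graph K_{2,6} as a minor. -/

import Mathlib

/-- `G` contains `K` as a minor: there are pairwise disjoint nonempty branch sets
`B w ⊆ V(G)`, each inducing a connected subgraph of `G`, such that every edge of `K`
is witnessed by an edge of `G` between the corresponding branch sets. -/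
def HasMinor {V W : Type*} (G : SimpleGraph V) (K : SimpleGraph W) : Prop :=
  ∃ B : W → Set V,
    (∀ w, (B w).Nonempty) ∧
    (∀ w₁ w₂, w₁ ≠ w₂ → Disjoint (B w₁) (B w₂)) ∧
    (∀ w, (G.induce (B w)).Connected) ∧
    (∀ w₁ w₂, K.Adj w₁ w₂ → ∃ u ∈ B w₁, ∃ v ∈ B w₂, G.Adj u v)

/-- Vertex labels in `Fin 14`: `0 = h¹`, `1 = h²`, `2 = h₁¹`, `3 = h₂¹`, `4 = h₃¹`,
`5 = h₁²`, `6 = h₂²`, `7 = h₃²`, `8 = h₁′`, `9 = h₁″`, `10 = h₂′`, `11 = h₂″`,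
`12 = h₃′`, `13 = h₃″`.  The edges `hʲhᵢʲ` of the Herschel graph are kept, each
vertex `hᵢ` is replaced by the two adjacent vertices `hᵢ′, hᵢ″`, where `hᵢ′` is
adjacent to `h_{i-1}¹, h_{i-1}²` and `hᵢ″` is adjacent to `hᵢ¹, hᵢ²`. -/
def splitHerschelEdges : List (Fin 14 × Fin 14) :=
  [(0,2),(0,3),(0,4),(1,5),(1,6),(1,7),
   (8,9),(10,11),(12,13),
   (8,4),(8,7),(10,2),(10,5),(12,3),(12,6),
   (9,2),(9,5),(11,3),(11,6),(13,4),(13,7)]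

/-- The graph `S` obtained from the Herschel graph by splitting each `hᵢ` into
two adjacent vertices `hᵢ′` and `hᵢ″`. -/
def SplitHerschel : SimpleGraph (Fin 14) :=
  SimpleGraph.fromRel (fun a b => (a, b) ∈ splitHerschelEdges)

instance : DecidableRel SplitHerschel.Adj := fun a b =>
  inferInstanceAs (Decidable (a ≠ b ∧ ((a, b) ∈ splitHerschelEdges ∨ (b, a) ∈ splitHerschelEdges)))

/-- A labelling of the vertices of `G` by those of `K` whose fibres are spanned by stars
exhibits `K` as a minor of `G` as soon as every edge of `K` is witnessed between fibres. -/
theorem HasMinor.of_star_fibres {V W : Type*} {G : SimpleGraph V} {K : SimpleGraph W}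
    (f : V → W) (c : W → V) (hc : ∀ w, f (c w) = w)
    (hstar : ∀ v, v = c (f v) ∨ G.Adj (c (f v)) v)
    (hadj : ∀ w₁ w₂, K.Adj w₁ w₂ → ∃ u v, f u = w₁ ∧ f v = w₂ ∧ G.Adj u v) :
    HasMinor G K := by
  refine ⟨fun w => f ⁻¹' {w}, fun w => ⟨c w, hc w⟩, fun w₁ w₂ h => ?_, fun w => ?_,
    fun w₁ w₂ h => ?_⟩
  · exact Disjoint.preimage f (Set.disjoint_singleton.2 h)
  · rw [SimpleGraph.connected_iff_exists_forall_reachable]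
    refine ⟨⟨c w, hc w⟩, ?_⟩
    rintro ⟨v, rfl⟩
    obtain h | h := hstar v
    · have : (⟨c (f v), hc _⟩ : f ⁻¹' {f v}) = ⟨v, rfl⟩ := Subtype.ext h.symm
      exact this ▸ SimpleGraph.Reachable.refl _
    · exact SimpleGraph.Adj.reachable (SimpleGraph.induce_adj.2 h)
  · obtain ⟨u, v, hu, hv, huv⟩ := hadj w₁ w₂ h
    exact ⟨u, hu, v, hv, huv⟩

/-- The branch set of each vertex: the closed neighbourhoods of `h¹` and `h²` form one side
of `K_{2,6}`, and the six split vertices form the other. -/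
def splitHerschelLabel : Fin 14 → Fin 2 ⊕ Fin 6 :=
  ![.inl 0, .inl 1, .inl 0, .inl 0, .inl 0, .inl 1, .inl 1, .inl 1,
    .inr 0, .inr 1, .inr 2, .inr 3, .inr 4, .inr 5]

theorem splitHerschelLabel_exists_adj (i : Fin 2) (j : Fin 6) :
    ∃ u v, splitHerschelLabel u = .inl i ∧ splitHerschelLabel v = .inr j ∧
      SplitHerschel.Adj u v := by
  revert i j
  decide

theorem splitHerschel_hasMinor_K26 :
    HasMinor SplitHerschel (completeBipartiteGraph (Fin 2) (Fin 6)) := by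
  refine HasMinor.of_star_fibres splitHerschelLabel
    (Sum.elim ![0, 1] ![8, 9, 10, 11, 12, 13]) (by decide) (by decide) ?_
  rintro (i | i) (j | j) h
  · simp at h
  · exact splitHerschelLabel_exists_adj i j
  · obtain ⟨u, v, hu, hv, huv⟩ := splitHerschelLabel_exists_adj j i
    exact ⟨v, u, hv, hu, huv.symm⟩
  · simp at h
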